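/- arXiv:0811.0796 — 3 statements merged into one kernel-verified Lean document; each statement's English description precedes it below -/
import Mathlib

section
/- A left-invariant ideal I on a group X is twinic if and only if the family of I-pretwin subsets of X is I-incomparable, i.e., for all I-pretwin sets A, B ⊆ X with A ⊆_I B one has A =_I B. -/
open Pointwise

/-- A left-invariant ideal on a group `X`. -/
def IsLeftInvariantIdeal {X : Type*} [Group X] (I : Set (Set X)) : Prop :=
  ∅ ∈ I ∧ Set.univ ∉ I ∧
  (∀ A ∈ I, ∀ B : Set X, B ⊆ A → B ∈ I) ∧
  (∀ A ∈ I, ∀ B ∈ I, A ∪ B ∈ I) ∧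
  (∀ A ∈ I, ∀ x : X, x • A ∈ I)

/-- A set `A ⊆ X` is `I`-pretwin if `xA ⊆_I X∖A` and `X∖A ⊆_I yA` for some `x, y ∈ X`. -/
def IsIPretwin {X : Type*} [Group X] (I : Set (Set X)) (A : Set X) : Prop :=
  ∃ x y : X, (x • A) \ Aᶜ ∈ I ∧ Aᶜ \ (y • A) ∈ I

/-- Left translates of `I`-pretwin sets are `I`-pretwin. -/
theorem IsIPretwin.smul {X : Type*} [Group X] {I : Set (Set X)} (hI : IsLeftInvariantIdeal I)
    {A : Set X} (hA : IsIPretwin I A) (g : X) : IsIPretwin I (g • A) := by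
  obtain ⟨-, -, -, -, hsmul⟩ := hI
  obtain ⟨x, y, hx, hy⟩ := hA
  refine ⟨g * x * g⁻¹, g * y * g⁻¹, ?_, ?_⟩
  · simpa [Set.smul_set_inter, smul_smul] using hsmul _ hx g
  · simpa [Set.smul_set_sdiff, Set.smul_set_compl, smul_smul] using hsmul _ hy g

/-- The relation `A ⊆_I B` is transitive. -/
theorem IsLeftInvariantIdeal.sdiff_trans {X : Type*} [Group X] {I : Set (Set X)}
    (hI : IsLeftInvariantIdeal I) {A B C : Set X} (hAB : A \ B ∈ I) (hBC : B \ C ∈ I) :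
    A \ C ∈ I := by
  obtain ⟨-, -, hsub, hunion, -⟩ := hI
  refine hsub _ (hunion _ hAB _ hBC) _ fun a ha => ?_
  by_cases hb : a ∈ B
  · exact Or.inr ⟨hb, ha.2⟩
  · exact Or.inl ⟨ha.1, hb⟩

/-- A left-invariant ideal `I` on a group `X` is twinic if and only if the
family of `I`-pretwin subsets of `X` is `I`-incomparable: `A ⊆_I B` implies `A =_I B` for
all `I`-pretwin sets `A, B`. -/
theorem stmt15 {X : Type*} [Group X] (I : Set (Set X)) (hI : IsLeftInvariantIdeal I) :
    (∀ (A : Set X) (x y : X), (x • A) \ Aᶜ ∈ I → Aᶜ \ (y • A) ∈ I →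
      ((x • A) \ (y • A) ∈ I ∧ (y • A) \ (x • A) ∈ I)) ↔
    (∀ A B : Set X, IsIPretwin I A → IsIPretwin I B → A \ B ∈ I →
      (A \ B ∈ I ∧ B \ A ∈ I)) := by
  constructor
  · rintro h A B ⟨u, y, -, hy⟩ ⟨x, v, hx, -⟩ hAB
    have hxAB : (x • A) \ (x • B) ∈ I := by
      rw [← Set.smul_set_sdiff]
      exact hI.2.2.2.2 _ hAB x
    have hxA : (x • A) \ Bᶜ ∈ I := hI.sdiff_trans hxAB hx
    have hcompl : Bᶜ \ Aᶜ ∈ I := by rwa [compl_sdiff_compl]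
    have hyx := (h A x y (hI.sdiff_trans hxA hcompl) hy).2
    refine ⟨hAB, ?_⟩
    rw [← compl_sdiff_compl]
    exact hI.sdiff_trans (hI.sdiff_trans hy hyx) hxA
  · intro h A x y hx hy
    have hA : IsIPretwin I A := ⟨x, y, hx, hy⟩
    exact h _ _ (hA.smul hI x) (hA.smul hI y) (hI.sdiff_trans hx hy)
end

section
/- Let I be a left-invariant ideal on a group X and let T̂ = {A ⊆ X : Fix⁻(A) is a maximal 2-cogroup of X}. Then T̂ is I-independent (i.e., for all A, B ∈ T̂, A =_I B implies A = B) if and only if no maximal 2-cogroup of X belongs to I. -/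
open Pointwise

/-- A (nonempty) subset `K` of a group `X` is a 2-cogroup if for every `x ∈ K` the shift
`xK = Kx` is the carrier of a subgroup of `X` disjoint from `K`. -/
def IsTwoCogroup {X : Type*} [Group X] (K : Set X) : Prop :=
  K.Nonempty ∧ ∀ x ∈ K,
    x • K = (fun k => k * x) '' K ∧
    (∃ H : Subgroup X, (H : Set X) = x • K) ∧
    Disjoint (x • K) K

/-- A maximal 2-cogroup: a 2-cogroup maximal by inclusion among 2-cogroups. -/
def IsMaxTwoCogroup {X : Type*} [Group X] (K : Set X) : Prop :=
  IsTwoCogroup K ∧ ∀ K' : Set X, IsTwoCogroup K' → K ⊆ K' → K' = K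

theorem isTwoCogroup_iff {X : Type*} [Group X] {K : Set X} :
    IsTwoCogroup K ↔ K.Nonempty ∧ ∃ G : Subgroup X, (∀ x ∈ K, x ∉ G) ∧
      (∀ x ∈ K, ∀ y, x * y ∈ G ↔ y ∈ K) ∧ (∀ x ∈ K, ∀ y, y * x ∈ G ↔ y ∈ K) := by
  constructor
  · rintro ⟨⟨x, hx⟩, h⟩
    obtain ⟨hcomm, ⟨G, hG⟩, hdisj⟩ := h x hx
    have hl : ∀ y, x * y ∈ G ↔ y ∈ K := fun y => by
      rw [← SetLike.mem_coe, hG, ← smul_eq_mul, Set.smul_mem_smul_set_iff]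
    have hr : ∀ y, y * x ∈ G ↔ y ∈ K := fun y => by
      rw [← SetLike.mem_coe, hG, hcomm]
      exact (mul_left_injective x).mem_set_image
    have hxx : x * x ∈ G := (hl x).2 hx
    refine ⟨⟨x, hx⟩, G, ?_, ?_, ?_⟩
    · intro y hy hyG
      rw [← hG] at hdisj
      exact Set.disjoint_left.1 hdisj hyG hy
    · intro z hz y
      have hzx : z * x⁻¹ ∈ G := by
        have := G.mul_mem ((hr z).2 hz) (G.inv_mem hxx)
        simpa [mul_assoc] using this
      rw [← hl y, ← G.mul_mem_cancel_left hzx (y := x * y)]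
      simp [mul_assoc]
    · intro z hz y
      have hzx : x⁻¹ * z ∈ G := by
        have := G.mul_mem (G.inv_mem hxx) ((hl z).2 hz)
        simpa [mul_assoc] using this
      rw [← hr y, ← G.mul_mem_cancel_right hzx (y := y * x)]
      simp [mul_assoc]
  · rintro ⟨hne, G, hd, hl, hr⟩
    refine ⟨hne, fun x hx => ?_⟩
    have h1 : x • K = G := by
      ext y
      rw [Set.mem_smul_set_iff_inv_smul_mem, smul_eq_mul, ← hl x hx, mul_inv_cancel_left]
      rfl
    have h2 : (fun k => k * x) '' K = G := by
      ext y
      rw [Set.image_mul_right, Set.mem_preimage, ← hr x hx, inv_mul_cancel_right]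
      rfl
    refine ⟨h1.trans h2.symm, ⟨G, h1.symm⟩, ?_⟩
    rw [h1]
    exact Set.disjoint_left.2 fun y hy hyK => hd y hyK hy

/-- Equality of sets modulo an ideal. -/
def EqModIdeal {X : Type*} (I : Set (Set X)) (A B : Set X) : Prop := symmDiff A B ∈ I

namespace EqModIdeal

variable {X : Type*} {I : Set (Set X)} {A B C : Set X}

theorem symm (h : EqModIdeal I A B) : EqModIdeal I B A := by
  rwa [EqModIdeal, symmDiff_comm]

theorem compl (h : EqModIdeal I A B) : EqModIdeal I Aᶜ Bᶜ := by
  rwa [EqModIdeal, compl_symmDiff_compl]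

variable [Group X]

theorem refl (hI : IsLeftInvariantIdeal I) (A : Set X) : EqModIdeal I A A := by
  simpa [EqModIdeal] using hI.1

theorem trans (hI : IsLeftInvariantIdeal I) (h : EqModIdeal I A B) (h' : EqModIdeal I B C) :
    EqModIdeal I A C :=
  hI.2.2.1 _ (hI.2.2.2.1 _ h _ h') _ (symmDiff_triangle A B C)

theorem smul (hI : IsLeftInvariantIdeal I) (h : EqModIdeal I A B) (x : X) :
    EqModIdeal I (x • A) (x • B) := by
  have := hI.2.2.2.2 _ h x
  rwa [Set.smul_set_symmDiff] at this

theorem not_compl (hI : IsLeftInvariantIdeal I) : ¬ EqModIdeal I A Aᶜ := by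
  intro h
  apply hI.2.1
  simpa [EqModIdeal] using h

end EqModIdeal

theorem isTwoCogroup_eqModIdeal_compl {X : Type*} [Group X] {I : Set (Set X)}
    (hI : IsLeftInvariantIdeal I) {A : Set X}
    (hne : {x : X | EqModIdeal I (x • A) Aᶜ}.Nonempty) :
    IsTwoCogroup {x : X | EqModIdeal I (x • A) Aᶜ} := by
  rw [isTwoCogroup_iff]
  let G : Subgroup X :=
    { carrier := {x | EqModIdeal I (x • A) A}
      one_mem' := by simpa using EqModIdeal.refl hI A
      mul_mem' := by
        intro x y hx hy
        have := (EqModIdeal.smul hI hy x).trans hI hx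
        rwa [smul_smul] at this
      inv_mem' := by
        intro x hx
        have := EqModIdeal.smul hI hx x⁻¹
        rw [inv_smul_smul] at this
        exact this.symm }
  have hG : ∀ x, x ∈ G ↔ EqModIdeal I (x • A) A := fun _ => Iff.rfl
  refine ⟨hne, G, ?_, ?_, ?_⟩
  · intro x hx hxG
    exact EqModIdeal.not_compl hI (EqModIdeal.trans hI (EqModIdeal.symm hxG) hx)
  · intro x hx y
    have hx' : EqModIdeal I (x • Aᶜ) A := by
      have := EqModIdeal.compl hx
      rwa [compl_compl, ← Set.smul_set_compl] at this
    rw [hG, Set.mem_ofPred_eq, mul_smul]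
    constructor
    · intro h
      have := (h.trans hI hx'.symm).smul hI x⁻¹
      rwa [inv_smul_smul, inv_smul_smul] at this
    · intro h
      exact (h.smul hI x).trans hI hx'
  · intro x hx y
    have h1 : EqModIdeal I (y • x • A) (y • A)ᶜ := by
      have := EqModIdeal.smul hI hx y
      rwa [Set.smul_set_compl] at this
    rw [hG, Set.mem_ofPred_eq, mul_smul]
    constructor
    · intro h
      have := (h1.symm.trans hI h).compl
      rwa [compl_compl] at this
    · intro h
      have := h.compl
      rw [compl_compl] at this
      exact h1.trans hI this

theorem isTwoCogroup_smul_eq_compl {X : Type*} [Group X] {A : Set X}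
    (hne : {x : X | x • A = Aᶜ}.Nonempty) : IsTwoCogroup {x : X | x • A = Aᶜ} := by
  have hI : IsLeftInvariantIdeal ({∅} : Set (Set X)) := by
    refine ⟨rfl, ?_, ?_, ?_, ?_⟩
    · exact Set.univ_nonempty.ne_empty
    · rintro A rfl B hB
      exact Set.subset_empty_iff.1 hB
    · rintro A rfl B rfl
      exact Set.union_self _
    · rintro A rfl x
      exact Set.smul_set_empty
  have heq : {x : X | EqModIdeal {∅} (x • A) Aᶜ} = {x : X | x • A = Aᶜ} := by
    ext x
    exact symmDiff_eq_bot
  rw [← heq] at hne ⊢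
  exact isTwoCogroup_eqModIdeal_compl hI hne

theorem IsTwoCogroup.conj {X : Type*} [Group X] {K : Set X} (hK : IsTwoCogroup K) (x : X) :
    IsTwoCogroup {y | x * y * x⁻¹ ∈ K} := by
  rw [isTwoCogroup_iff] at hK ⊢
  obtain ⟨⟨k, hk⟩, G, hd, hl, hr⟩ := hK
  refine ⟨⟨x⁻¹ * k * x, by simpa [mul_assoc] using hk⟩,
    G.comap (MulAut.conj x).toMonoidHom, ?_, ?_, ?_⟩
  · intro y hy
    exact hd _ hy
  · intro y hy z
    have := hl _ hy (x * z * x⁻¹)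
    simpa [mul_assoc] using this
  · intro y hy z
    have := hr _ hy (x * z * x⁻¹)
    simpa [mul_assoc] using this

theorem IsMaxTwoCogroup.conj {X : Type*} [Group X] {K : Set X} (hK : IsMaxTwoCogroup K) (x : X) :
    IsMaxTwoCogroup {y | x * y * x⁻¹ ∈ K} := by
  refine ⟨hK.1.conj x, fun K' hK' hle => ?_⟩
  have h := hK.2 _ (hK'.conj x⁻¹) fun y hy => by
    refine hle ?_
    simpa [mul_assoc] using hy
  ext y
  rw [← h]
  simp [mul_assoc]

theorem IsMaxTwoCogroup.eq_eqModIdeal_compl {X : Type*} [Group X] {I : Set (Set X)}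
    (hI : IsLeftInvariantIdeal I) {A B : Set X} (hA : IsMaxTwoCogroup {x : X | x • A = Aᶜ})
    (hAB : EqModIdeal I A B) :
    {x : X | EqModIdeal I (x • B) Bᶜ} = {x : X | x • A = Aᶜ} := by
  have hle : {x : X | x • A = Aᶜ} ⊆ {x : X | EqModIdeal I (x • B) Bᶜ} := by
    intro x hx
    have h := hAB.symm.smul hI x
    rw [Set.mem_ofPred_eq.mp hx] at h
    exact h.trans hI hAB.compl
  exact hA.2 _ (isTwoCogroup_eqModIdeal_compl hI (hA.1.1.mono hle)) hle

/-- If every element of a maximal 2-cogroup `K` moves `A` and `B` to their complements, then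
`x ∈ A \ B` implies `K x ⊆ B \ A`; so `B \ A ∈ I` forces `A ⊆ B` when `I` contains no maximal
2-cogroup. -/
theorem subset_of_diff_mem_of_smul_eq_compl {X : Type*} [Group X] {I : Set (Set X)}
    (hI : IsLeftInvariantIdeal I) (hmax : ∀ K : Set X, IsMaxTwoCogroup K → K ∉ I)
    {K A B : Set X} (hK : IsMaxTwoCogroup K) (hA : ∀ k ∈ K, k • A = Aᶜ)
    (hB : ∀ k ∈ K, k • B = Bᶜ) (h : B \ A ∈ I) : A ⊆ B := by
  intro x hxA
  by_contra hxB
  refine hmax _ (hK.conj x) (hI.2.2.1 _ (hI.2.2.2.2 _ h x⁻¹) _ ?_)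
  intro y hy
  rw [Set.mem_smul_set_iff_inv_smul_mem, inv_inv, smul_eq_mul]
  have key : ∀ C : Set X, (∀ k ∈ K, k • C = Cᶜ) → (x ∈ C ↔ x * y ∉ C) := by
    intro C hC
    rw [← Set.mem_compl_iff, ← hC _ hy, Set.mem_smul_set_iff_inv_smul_mem]
    simp [mul_assoc]
  exact ⟨not_not.1 (mt (key B hB).2 hxB), (key A hA).1 hxA⟩

theorem exists_subgroup_mem_iff_mem_or_mem {X : Type*} [Group X] {K : Set X} {G : Subgroup X}
    (hl : ∀ x ∈ K, ∀ y, x * y ∈ G ↔ y ∈ K) (hr : ∀ x ∈ K, ∀ y, y * x ∈ G ↔ y ∈ K) :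
    ∃ W : Subgroup X, ∀ x, x ∈ W ↔ x ∈ G ∨ x ∈ K := by
  refine ⟨{ carrier := {x | x ∈ G ∨ x ∈ K}
            one_mem' := Or.inl G.one_mem
            mul_mem' := ?_
            inv_mem' := ?_ }, fun _ => Iff.rfl⟩
  · rintro x y (hx | hx) (hy | hy)
    · exact Or.inl (G.mul_mem hx hy)
    · refine Or.inr ((hr y hy _).1 ?_)
      rw [mul_assoc]
      exact G.mul_mem hx ((hl y hy y).2 hy)
    · refine Or.inr ((hl x hx _).1 ?_)
      rw [← mul_assoc]
      exact G.mul_mem ((hl x hx x).2 hx) hy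
    · exact Or.inl ((hl x hx y).2 hy)
  · rintro x (hx | hx)
    · exact Or.inl (G.inv_mem hx)
    · exact Or.inr ((hl x hx _).1 (by simp))

theorem exists_smul_eq_compl {X : Type*} [Group X] {K : Set X} {G W : Subgroup X}
    (hd : ∀ x ∈ K, x ∉ G) (hl : ∀ x ∈ K, ∀ y, x * y ∈ G ↔ y ∈ K)
    (hW : ∀ x, x ∈ W ↔ x ∈ G ∨ x ∈ K) : ∃ A : Set X, ∀ k ∈ K, k • A = Aᶜ := by
  let rep : X → X := fun y => (Quotient.mk (QuotientGroup.rightRel W) y).out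
  have hrep : ∀ y, y * (rep y)⁻¹ ∈ W := fun y =>
    QuotientGroup.rightRel_apply.1 (Quotient.mk_out (s := QuotientGroup.rightRel W) y)
  refine ⟨{y | y * (rep y)⁻¹ ∈ G}, fun k hk => ?_⟩
  ext y
  have hky : rep (k⁻¹ * y) = rep y := by
    refine congrArg Quotient.out (Quotient.sound ?_)
    refine QuotientGroup.rightRel_apply.2 ?_
    simpa using (hW k).2 (Or.inr hk)
  rw [Set.mem_smul_set_iff_inv_smul_mem, smul_eq_mul, Set.mem_compl_iff, Set.mem_ofPred_eq,
    Set.mem_ofPred_eq, hky, mul_assoc]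
  have hk' : k⁻¹ ∈ K := (hl k hk _).1 (by simp)
  rw [hl _ hk']
  exact ⟨hd _, ((hW _).1 (hrep y)).resolve_left⟩

/-- For a left-invariant ideal `I` on a group `X`, the family
`T̂ = {A ⊆ X : Fix⁻(A) is a maximal 2-cogroup}` is `I`-independent (i.e. `A =_I B` implies
`A = B` for `A, B ∈ T̂`) if and only if no maximal 2-cogroup of `X` belongs to `I`. -/
theorem stmt16 {X : Type*} [Group X] (I : Set (Set X)) (hI : IsLeftInvariantIdeal I) :
    (∀ A B : Set X, IsMaxTwoCogroup {x : X | x • A = Aᶜ} →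
      IsMaxTwoCogroup {x : X | x • B = Bᶜ} →
      A \ B ∈ I → B \ A ∈ I → A = B) ↔
    (∀ K : Set X, IsMaxTwoCogroup K → K ∉ I) := by
  constructor
  · intro hind K hK hKI
    obtain ⟨⟨k₀, hk₀⟩, G, hd, hl, hr⟩ := isTwoCogroup_iff.1 hK.1
    obtain ⟨W, hW⟩ := exists_subgroup_mem_iff_mem_or_mem hl hr
    obtain ⟨A, hA⟩ := exists_smul_eq_compl hd hl hW
    have hmax : ∀ C : Set X, (∀ k ∈ K, k • C = Cᶜ) → IsMaxTwoCogroup {x : X | x • C = Cᶜ} := by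
      intro C hC
      rwa [hK.2 _ (isTwoCogroup_smul_eq_compl ⟨k₀, hC k₀ hk₀⟩) hC]
    have hB : ∀ k ∈ K, k • symmDiff A (W : Set X) = (symmDiff A (W : Set X))ᶜ := by
      intro k hk
      have hkW : k • (W : Set X) = W := smul_coe_set ((hW k).2 (Or.inr hk))
      rw [Set.smul_set_symmDiff, hA k hk, hkW]
      ext y
      simp only [Set.mem_symmDiff, Set.mem_compl_iff]
      tauto
    have hWI : (W : Set X) ∈ I := by
      refine hI.2.2.1 _ (hI.2.2.2.1 _ (hI.2.2.2.2 _ hKI k₀) _ hKI) _ fun y hy => ?_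
      refine ((hW y).1 hy).imp (fun hyG => ?_) id
      rw [Set.mem_smul_set_iff_inv_smul_mem, smul_eq_mul, ← hl k₀ hk₀, mul_inv_cancel_left]
      exact hyG
    have hAB := hind _ _ (hmax _ hA) (hmax _ hB)
      (hI.2.2.1 _ hWI _ fun y hy => by
        simp only [Set.mem_sdiff, Set.mem_symmDiff] at hy
        tauto)
      (hI.2.2.1 _ hWI _ fun y hy => by
        simp only [Set.mem_sdiff, Set.mem_symmDiff] at hy
        tauto)
    have hbot : (W : Set X) = ∅ := symmDiff_eq_left.1 hAB.symm
    exact Set.notMem_empty (1 : X) (hbot ▸ W.one_mem)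
  · intro hmax A B hA hB hAB hBA
    have hE : EqModIdeal I A B := hI.2.2.2.1 _ hAB _ hBA
    have h : {x : X | x • A = Aᶜ} = {x : X | x • B = Bᶜ} :=
      (hA.eq_eqModIdeal_compl hI hE).symm.trans
        (hB.eq_eqModIdeal_compl hI (EqModIdeal.refl hI B))
    have hB' : ∀ k ∈ {x : X | x • A = Aᶜ}, k • B = Bᶜ := fun k hk => by
      rw [h] at hk
      exact hk
    exact Set.Subset.antisymm
      (subset_of_diff_mem_of_smul_eq_compl hI hmax hA (fun _ hk => hk) hB' hBA)
      (subset_of_diff_mem_of_smul_eq_compl hI hmax hA hB' (fun _ hk => hk) hAB)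
end

section
/- Let X be a twinic group and let Enl denote the monoid, under composition, of all equivariant monotone symmetric functions P(X) → P(X). Let T̂ = {A ⊆ X : Fix⁻(A) is a maximal 2-cogroup of X}. For f ∈ Enl the following are equivalent: (i) f belongs to the minimal ideal of Enl, i.e., for every g ∈ Enl there exists h ∈ Enl with h∘g∘f = f; (ii) the family f(T̂) = {f(A) : A ∈ T̂} is minimal K̂-covering, and f(A) ∈ {∅, X} ∪ f(T̂) for every A ⊆ X. -/
open Pointwise

/-- A left-invariant ideal `I` on a group `X` is twinic if `xA ⊆_I X∖A ⊆_I yA` implies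
`xA =_I yA`. -/
def IsTwinicIdeal {X : Type*} [Group X] (I : Set (Set X)) : Prop :=
  ∀ (A : Set X) (x y : X), (x • A) \ Aᶜ ∈ I → Aᶜ \ (y • A) ∈ I →
    ((x • A) \ (y • A) ∈ I ∧ (y • A) \ (x • A) ∈ I)

/-- A function `P(X) → P(X)` is equivariant, monotone and symmetric (an element of the
function representation `Enl(P(X))` of the superextension `λ(X)`). -/
def IsEnl {X : Type*} [Group X] (f : Set X → Set X) : Prop :=
  (∀ (x : X) (A : Set X), f (x • A) = x • f A) ∧
  (∀ A B : Set X, A ⊆ B → f A ⊆ f B) ∧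
  (∀ A : Set X, f Aᶜ = (f A)ᶜ)

/-- The family `T̂` of twin sets `A ⊆ X` whose 2-cogroup `Fix⁻(A) = {x : xA = X∖A}` is a
maximal 2-cogroup. -/
def TwinHat (X : Type*) [Group X] : Set (Set X) :=
  {A : Set X | IsMaxTwoCogroup {x : X | x • A = Aᶜ}}

/-- A family `F` of subsets of `X` is `K̂`-covering if it is left-invariant and every maximal
2-cogroup `K` equals `Fix⁻(A)` for some `A ∈ F`. -/
def IsKCovering {X : Type*} [Group X] (F : Set (Set X)) : Prop :=
  (∀ A ∈ F, ∀ x : X, x • A ∈ F) ∧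
  (∀ K : Set X, IsMaxTwoCogroup K → ∃ A ∈ F, {x : X | x • A = Aᶜ} = K)

/-- A family is minimal `K̂`-covering if it is `K̂`-covering and coincides with each of its
`K̂`-covering subfamilies. -/
def IsMinKCovering {X : Type*} [Group X] (F : Set (Set X)) : Prop :=
  IsKCovering F ∧ ∀ F' : Set (Set X), F' ⊆ F → IsKCovering F' → F' = F

section Cogroups

variable {X : Type*} [Group X]

theorem isTwoCogroup_iff_s19 {K : Set X} : IsTwoCogroup K ↔
    K.Nonempty ∧ (∀ a ∈ K, a⁻¹ ∈ K) ∧ (∀ a ∈ K, ∀ b ∈ K, a * b ∉ K) ∧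
      ∀ a ∈ K, ∀ b ∈ K, ∀ c ∈ K, a * b * c ∈ K := by
  constructor
  · rintro ⟨hne, hK⟩
    refine ⟨hne, fun a ha => ?_, fun a ha b hb => ?_, fun a ha b hb c hc => ?_⟩
    · obtain ⟨-, ⟨H, hH⟩, -⟩ := hK a ha
      have h1 : (1 : X) ∈ a • K := hH ▸ H.one_mem
      rwa [Set.mem_smul_set_iff_inv_smul_mem, smul_eq_mul, mul_one] at h1
    · exact Set.disjoint_left.1 (hK a ha).2.2 (Set.smul_mem_smul_set hb)
    · obtain ⟨hcomm, ⟨H, hH⟩, -⟩ := hK a ha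
      have hab : a * b ∈ H := by
        rw [← SetLike.mem_coe, hH]; exact Set.smul_mem_smul_set hb
      have hac : a * c ∈ H := by
        rw [← SetLike.mem_coe, hH]; exact Set.smul_mem_smul_set hc
      have hab' : a * b ∈ (fun k => k * a) '' K := by
        rw [← hcomm]; exact Set.smul_mem_smul_set hb
      obtain ⟨k, hk, hka⟩ := hab'
      have hak : a * k ∈ H := by
        rw [← SetLike.mem_coe, hH]; exact Set.smul_mem_smul_set hk
      have key : a * (a * b * c) ∈ H := by
        have : a * (a * b * c) = (a * k) * (a * c) := by
          have hka : k * a = a * b := hka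
          rw [← hka]; group
        rw [this]; exact H.mul_mem hak hac
      rw [← SetLike.mem_coe, hH] at key
      exact (Set.smul_mem_smul_set_iff (a := a)).1 key
  · rintro ⟨hne, hinv, hmul, htri⟩
    refine ⟨hne, fun x hx => ⟨?_, ⟨⟨⟨⟨x • K, ?_⟩, ?_⟩, ?_⟩, rfl⟩, ?_⟩⟩
    · ext y
      simp only [Set.mem_smul_set, smul_eq_mul, Set.mem_image]
      constructor
      · rintro ⟨k, hk, rfl⟩
        exact ⟨x * k * x⁻¹, htri x hx k hk _ (hinv x hx), by group⟩
      · rintro ⟨k, hk, rfl⟩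
        exact ⟨x⁻¹ * k * x, htri _ (hinv x hx) k hk x hx, by group⟩
    · rintro _ _ ⟨k, hk, rfl⟩ ⟨l, hl, rfl⟩
      exact ⟨k * x * l, htri k hk x hx l hl, by simp [mul_assoc]⟩
    · exact ⟨x⁻¹, hinv x hx, by simp⟩
    · rintro _ ⟨k, hk, rfl⟩
      exact ⟨x⁻¹ * k⁻¹ * x⁻¹, htri _ (hinv x hx) _ (hinv k hk) _ (hinv x hx), by
        simp [mul_assoc]⟩
    · rw [Set.disjoint_left]
      rintro _ ⟨k, hk, rfl⟩
      exact hmul x hx k hk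

theorem IsTwoCogroup.exists_isMaxTwoCogroup {K : Set X} (hK : IsTwoCogroup K) :
    ∃ M, IsMaxTwoCogroup M ∧ K ⊆ M := by
  obtain ⟨M, hKM, hM⟩ := zorn_subset_nonempty {K : Set X | IsTwoCogroup K} (by
    intro c hc hchain hcne
    refine ⟨⋃₀ c, ?_, fun s hs => Set.subset_sUnion_of_mem hs⟩
    have two : ∀ s ∈ c, ∀ t ∈ c, ∃ u ∈ c, s ⊆ u ∧ t ⊆ u := fun s hs t ht =>
      hchain.directedOn s hs t ht
    rw [Set.mem_ofPred_eq, isTwoCogroup_iff_s19]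
    refine ⟨?_, ?_, ?_, ?_⟩
    · obtain ⟨s, hs⟩ := hcne
      obtain ⟨x, hx⟩ := (isTwoCogroup_iff_s19.1 (hc hs)).1
      exact ⟨x, s, hs, hx⟩
    · rintro a ⟨s, hs, ha⟩
      exact ⟨s, hs, (isTwoCogroup_iff_s19.1 (hc hs)).2.1 a ha⟩
    · rintro a ⟨s, hs, ha⟩ b ⟨t, ht, hb⟩ ⟨r, hr, hab⟩
      obtain ⟨u, hu, hsu, htu⟩ := two s hs t ht
      obtain ⟨v, hv, huv, hrv⟩ := two u hu r hr
      exact (isTwoCogroup_iff_s19.1 (hc hv)).2.2.1 a (huv (hsu ha)) b (huv (htu hb)) (hrv hab)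
    · rintro a ⟨s, hs, ha⟩ b ⟨t, ht, hb⟩ d ⟨r, hr, hd⟩
      obtain ⟨u, hu, hsu, htu⟩ := two s hs t ht
      obtain ⟨v, hv, huv, hrv⟩ := two u hu r hr
      exact ⟨v, hv, (isTwoCogroup_iff_s19.1 (hc hv)).2.2.2 a (huv (hsu ha)) b (huv (htu hb)) d
        (hrv hd)⟩) K hK
  exact ⟨M, ⟨hM.prop, fun K' hK' h => (hM.eq_of_subset hK' h).symm⟩, hKM⟩

/-- The subgroup `K ∪ K⁻¹K` generated by a 2-cogroup `K`. -/
def IsTwoCogroup.subgroup {K : Set X} (hK : IsTwoCogroup K) : Subgroup X where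
  carrier := {t | t ∈ K ∨ ∃ p ∈ K, p * t ∈ K}
  one_mem' := by
    obtain ⟨⟨p, hp⟩, -⟩ := isTwoCogroup_iff_s19.1 hK
    exact Or.inr ⟨p, hp, by simpa using hp⟩
  inv_mem' := by
    obtain ⟨-, hinv, -, -⟩ := isTwoCogroup_iff_s19.1 hK
    rintro t (ht | ⟨p, hp, hpt⟩)
    · exact Or.inl (hinv t ht)
    · exact Or.inr ⟨p * t, hpt, by simpa using hp⟩
  mul_mem' := by
    obtain ⟨-, hinv, -, htri⟩ := isTwoCogroup_iff_s19.1 hK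
    rintro s t (hs | ⟨p, hp, hps⟩) (ht | ⟨q, hq, hqt⟩)
    · exact Or.inr ⟨s⁻¹, hinv s hs, by simpa using ht⟩
    · refine Or.inl ?_
      have := htri s hs q⁻¹ (hinv q hq) (q * t) hqt
      simpa [mul_assoc] using this
    · refine Or.inl ?_
      have := htri p⁻¹ (hinv p hp) (p * s) hps t ht
      simpa [mul_assoc] using this
    · refine Or.inr ⟨p, hp, ?_⟩
      have := htri (p * s) hps q⁻¹ (hinv q hq) (q * t) hqt
      simpa [mul_assoc] using this

theorem IsTwoCogroup.exists_subset_setOf_smul_eq_compl {K : Set X} (hK : IsTwoCogroup K) :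
    ∃ A : Set X, K ⊆ {x : X | x • A = Aᶜ} := by
  obtain ⟨-, hinv, hmul, htri⟩ := isTwoCogroup_iff_s19.1 hK
  let r := QuotientGroup.rightRel hK.subgroup
  let s : X → X := fun a => (Quotient.mk r a).out
  have hs : ∀ a, a * (s a)⁻¹ ∈ K ∨ ∃ p ∈ K, p * (a * (s a)⁻¹) ∈ K := by
    intro a
    have h : r (s a) a := Quotient.exact (Quotient.out_eq (Quotient.mk r a))
    exact QuotientGroup.rightRel_apply.1 h
  refine ⟨{a | a * (s a)⁻¹ ∉ K}, fun k hk => ?_⟩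
  ext a
  have hsa : s (k⁻¹ * a) = s a := by
    have : Quotient.mk r (k⁻¹ * a) = Quotient.mk r a := by
      refine Quotient.sound (QuotientGroup.rightRel_apply.2 ?_)
      exact Or.inl (by simpa using hk)
    simp only [s, this]
  rw [Set.mem_smul_set_iff_inv_smul_mem]
  simp only [smul_eq_mul, Set.mem_ofPred_eq, hsa, Set.mem_compl_iff, not_not]
  constructor
  · intro h
    rcases hs a with h' | ⟨p, hp, hpt⟩
    · exact h'
    · refine absurd ?_ h
      have := htri k⁻¹ (hinv k hk) p⁻¹ (hinv p hp) _ hpt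
      simpa [mul_assoc] using this
  · intro h h'
    exact hmul k⁻¹ (hinv k hk) _ h (by simpa [mul_assoc] using h')

end Cogroups

section Ideals

variable {X : Type*}

/-- Equality of sets modulo an ideal. -/
def EqMod (I : Set (Set X)) (A B : Set X) : Prop :=
  A \ B ∈ I ∧ B \ A ∈ I

theorem compl_diff_compl_mem {I : Set (Set X)} {A B : Set X} (h : A \ B ∈ I) :
    Bᶜ \ Aᶜ ∈ I := by
  have : Bᶜ \ Aᶜ = A \ B := by ext; simp [and_comm]
  rwa [this]

theorem EqMod.symm {I : Set (Set X)} {A B : Set X} (h : EqMod I A B) : EqMod I B A :=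
  ⟨h.2, h.1⟩

theorem EqMod.compl {I : Set (Set X)} {A B : Set X} (h : EqMod I A B) : EqMod I Aᶜ Bᶜ :=
  ⟨compl_diff_compl_mem h.2, compl_diff_compl_mem h.1⟩

theorem eqMod_singleton_empty {A B : Set X} : EqMod {∅} A B ↔ A = B := by
  simp only [EqMod, Set.mem_singleton_iff, Set.sdiff_eq_empty]
  exact ⟨fun h => h.1.antisymm h.2, fun h => ⟨h.le, h.ge⟩⟩

variable [Group X]

namespace IsLeftInvariantIdeal

variable {I : Set (Set X)} (hI : IsLeftInvariantIdeal I) {A B C : Set X}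
include hI

theorem diff_trans (h : A \ B ∈ I) (h' : B \ C ∈ I) : A \ C ∈ I := by
  refine hI.2.2.1 _ (hI.2.2.2.1 _ h _ h') _ ?_
  intro x hx
  by_cases hB : x ∈ B
  · exact Or.inr ⟨hB, hx.2⟩
  · exact Or.inl ⟨hx.1, hB⟩

theorem diff_smul (h : A \ B ∈ I) (x : X) : (x • A) \ (x • B) ∈ I := by
  rw [← Set.smul_set_sdiff]
  exact hI.2.2.2.2 _ h x

theorem diff_of_subset (h : A ⊆ B) : A \ B ∈ I := by
  rw [Set.sdiff_eq_empty.2 h]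
  exact hI.1

theorem eqMod_refl (A : Set X) : EqMod I A A :=
  ⟨hI.diff_of_subset le_rfl, hI.diff_of_subset le_rfl⟩

theorem eqMod_trans (h : EqMod I A B) (h' : EqMod I B C) : EqMod I A C :=
  ⟨hI.diff_trans h.1 h'.1, hI.diff_trans h'.2 h.2⟩

theorem eqMod_smul (h : EqMod I A B) (x : X) : EqMod I (x • A) (x • B) :=
  ⟨hI.diff_smul h.1 x, hI.diff_smul h.2 x⟩

end IsLeftInvariantIdeal

theorem isLeftInvariantIdeal_singleton_empty :
    IsLeftInvariantIdeal ({∅} : Set (Set X)) := by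
  refine ⟨rfl, ?_, ?_, ?_, ?_⟩
  · exact Set.univ_nonempty.ne_empty
  · rintro A rfl B h
    exact Set.subset_empty_iff.1 h
  · rintro A rfl B rfl
    simp
  · rintro A rfl x
    simp

namespace IsLeftInvariantIdeal

variable {I : Set (Set X)} (hI : IsLeftInvariantIdeal I)
include hI

theorem not_eqMod_compl (A : Set X) : ¬ EqMod I A Aᶜ := by
  rintro ⟨h, h'⟩
  refine hI.2.1 (hI.2.2.1 _ (hI.2.2.2.1 _ h _ h') _ ?_)
  intro x _
  by_cases hx : x ∈ A <;> simp

theorem isTwoCogroup_setOf_eqMod {A : Set X}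
    (hA : {x : X | EqMod I (x • A) Aᶜ}.Nonempty) :
    IsTwoCogroup {x : X | EqMod I (x • A) Aᶜ} := by
  have hmul : ∀ a b : X, EqMod I (a • A) Aᶜ → EqMod I (b • A) Aᶜ →
      EqMod I ((a * b) • A) A := by
    intro a b ha hb
    have h1 := hI.eqMod_smul hb a
    rw [smul_smul, Set.smul_set_compl] at h1
    have h2 := ha.compl
    rw [compl_compl] at h2
    exact hI.eqMod_trans h1 h2
  refine isTwoCogroup_iff_s19.2 ⟨hA, fun a ha => ?_, fun a ha b hb hab => ?_,
    fun a ha b hb c hc => ?_⟩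
  · have h := hI.eqMod_smul (show EqMod I (a • A) Aᶜ from ha) a⁻¹
    rw [inv_smul_smul, Set.smul_set_compl] at h
    have h := h.compl.symm
    rwa [compl_compl] at h
  · exact hI.not_eqMod_compl A (hI.eqMod_trans (hmul a b ha hb).symm hab)
  · have h := hI.eqMod_smul (hmul b c hb hc) a
    rw [smul_smul, ← mul_assoc] at h
    exact hI.eqMod_trans h ha

end IsLeftInvariantIdeal

theorem isTwoCogroup_setOf_smul_eq_compl {A : Set X} (hA : {x : X | x • A = Aᶜ}.Nonempty) :
    IsTwoCogroup {x : X | x • A = Aᶜ} := by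
  have h := isLeftInvariantIdeal_singleton_empty.isTwoCogroup_setOf_eqMod (A := A)
  simp only [eqMod_singleton_empty] at h
  exact h hA

theorem IsMaxTwoCogroup.exists_setOf_smul_eq_compl {K : Set X} (hK : IsMaxTwoCogroup K) :
    ∃ A : Set X, {x : X | x • A = Aᶜ} = K := by
  obtain ⟨A, hA⟩ := hK.1.exists_subset_setOf_smul_eq_compl
  exact ⟨A, hK.2 _ (isTwoCogroup_setOf_smul_eq_compl (hK.1.1.mono hA)) hA⟩

theorem smul_smul_set_eq_compl_iff {A : Set X} {x y : X} :
    y • (x • A) = (x • A)ᶜ ↔ (x⁻¹ * y * x) • A = Aᶜ := by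
  rw [← Set.smul_set_compl, smul_smul, mul_assoc, ← smul_smul x⁻¹, inv_smul_eq_iff]

theorem setOf_smul_eq_compl_smul_congr {A B : Set X}
    (h : {y : X | y • A = Aᶜ} = {y : X | y • B = Bᶜ}) (x : X) :
    {y : X | y • x • A = (x • A)ᶜ} = {y : X | y • x • B = (x • B)ᶜ} := by
  ext y
  simp only [Set.mem_ofPred_eq, smul_smul_set_eq_compl_iff]
  exact Set.ext_iff.1 h _

theorem smul_eq_iff_of_setOf_smul_eq_compl_eq {A B : Set X}
    (hne : {y : X | y • A = Aᶜ}.Nonempty)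
    (h : {y : X | y • A = Aᶜ} = {y : X | y • B = Bᶜ}) (x : X) :
    x • A = A ↔ x • B = B := by
  obtain ⟨k, hk⟩ := hne
  have hkB : k • B = Bᶜ := (Set.ext_iff.1 h k).1 hk
  have hk : k • A = Aᶜ := hk
  have := Set.ext_iff.1 h (x * k)
  simp only [Set.mem_ofPred_eq, ← smul_smul, hk, hkB, Set.smul_set_compl, compl_inj_iff] at this
  exact this

theorem smul_mem_twinHat {A : Set X} (hA : A ∈ TwinHat X) (x : X) : x • A ∈ TwinHat X := by
  obtain ⟨hK, hmax⟩ := hA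
  have conj : ∀ (y : X) (K : Set X), IsTwoCogroup K →
      IsTwoCogroup {z | y * z * y⁻¹ ∈ K} := by
    intro y K hK
    obtain ⟨⟨k, hk⟩, hinv, hmul, htri⟩ := isTwoCogroup_iff_s19.1 hK
    refine isTwoCogroup_iff_s19.2 ⟨⟨y⁻¹ * k * y, by simpa [mul_assoc] using hk⟩, fun a ha => ?_,
      fun a ha b hb hab => ?_, fun a ha b hb c hc => ?_⟩
    · simpa [mul_assoc] using hinv _ ha
    · exact hmul _ ha _ hb (by simpa [mul_assoc] using hab)
    · simpa [mul_assoc] using htri _ ha _ hb _ hc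
  have heq : {y : X | y • x • A = (x • A)ᶜ} = {y | x⁻¹ * y * x⁻¹⁻¹ ∈ {y : X | y • A = Aᶜ}} := by
    ext y
    simp only [Set.mem_ofPred_eq, smul_smul_set_eq_compl_iff, inv_inv]
  refine ⟨heq ▸ conj _ _ hK, fun K' hK' hsub => ?_⟩
  rw [heq] at hsub ⊢
  have h := hmax _ (conj x K' hK') (fun z hz => hsub (by
    simpa [mul_assoc] using hz))
  rw [← h]
  ext z
  simp [mul_assoc]

theorem isKCovering_twinHat : IsKCovering (TwinHat X) := by
  refine ⟨fun A hA x => smul_mem_twinHat hA x, fun K hK => ?_⟩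
  obtain ⟨A, rfl⟩ := hK.exists_setOf_smul_eq_compl
  exact ⟨A, hK, rfl⟩

theorem TwinHat.nonempty_setOf {A : Set X} (hA : A ∈ TwinHat X) :
    {x : X | x • A = Aᶜ}.Nonempty :=
  hA.1.1

theorem TwinHat.ne_empty {A : Set X} (hA : A ∈ TwinHat X) : A ≠ ∅ := by
  rintro rfl
  obtain ⟨x, hx⟩ := TwinHat.nonempty_setOf hA
  simp [Set.empty_ne_univ] at hx

theorem TwinHat.ne_univ {A : Set X} (hA : A ∈ TwinHat X) : A ≠ Set.univ := by
  rintro rfl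
  obtain ⟨x, hx⟩ := TwinHat.nonempty_setOf hA
  simp at hx

end Ideals

section Enl

variable {X : Type*} [Group X]

namespace IsEnl

variable {f : Set X → Set X} (hf : IsEnl f)
include hf

theorem map_smul (x : X) (A : Set X) : f (x • A) = x • f A := hf.1 x A

theorem mono {A B : Set X} (h : A ⊆ B) : f A ⊆ f B := hf.2.1 A B h

theorem map_compl (A : Set X) : f Aᶜ = (f A)ᶜ := hf.2.2 A

theorem map_empty : f ∅ = ∅ := by
  have h := hf.mono (Set.empty_subset (∅ : Set X)ᶜ)
  rw [hf.map_compl] at h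
  exact Set.eq_empty_of_forall_notMem fun x hx => h hx hx

theorem map_univ : f Set.univ = Set.univ := by
  rw [← Set.compl_empty, hf.map_compl, hf.map_empty]

theorem comp {g : Set X → Set X} (hg : IsEnl g) : IsEnl (g ∘ f) :=
  ⟨fun x A => by simp [hf.map_smul, hg.map_smul], fun A B h => hg.mono (hf.mono h),
    fun A => by simp [hf.map_compl, hg.map_compl]⟩

theorem setOf_smul_eq_compl_map {A : Set X} (hA : A ∈ TwinHat X) :
    {x : X | x • f A = (f A)ᶜ} = {x : X | x • A = Aᶜ} := by
  have hsub : {x : X | x • A = Aᶜ} ⊆ {x : X | x • f A = (f A)ᶜ} := by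
    intro x (hx : x • A = Aᶜ)
    rw [Set.mem_ofPred_eq, ← hf.map_smul, hx, hf.map_compl]
  exact hA.2 _ (isTwoCogroup_setOf_smul_eq_compl (hA.1.1.mono hsub)) hsub

theorem map_mem_twinHat {A : Set X} (hA : A ∈ TwinHat X) : f A ∈ TwinHat X := by
  rw [TwinHat, Set.mem_ofPred_eq, hf.setOf_smul_eq_compl_map hA]
  exact hA

theorem isKCovering_image {F : Set (Set X)} (hF : IsKCovering F) (hFT : F ⊆ TwinHat X) :
    IsKCovering (f '' F) := by
  refine ⟨?_, fun K hK => ?_⟩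
  · rintro _ ⟨A, hA, rfl⟩ x
    exact ⟨x • A, hF.1 A hA x, hf.map_smul x A⟩
  · obtain ⟨A, hA, rfl⟩ := hF.2 K hK
    exact ⟨f A, ⟨A, hA, rfl⟩, hf.setOf_smul_eq_compl_map (hFT hA)⟩

theorem isMinKCovering_image {F : Set (Set X)} (hF : IsMinKCovering F) (hFT : F ⊆ TwinHat X) :
    IsMinKCovering (f '' F) := by
  refine ⟨hf.isKCovering_image hF.1 hFT, fun F' hsub hF' => hsub.antisymm ?_⟩
  have key : F ∩ f ⁻¹' F' = F := by
    refine hF.2 _ Set.inter_subset_left ⟨fun A hA x => ⟨hF.1.1 A hA.1 x, ?_⟩, fun K hK => ?_⟩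
    · rw [Set.mem_preimage, hf.map_smul]
      exact hF'.1 _ hA.2 x
    · obtain ⟨B, hB, rfl⟩ := hF'.2 K hK
      obtain ⟨A, hA, rfl⟩ := hsub hB
      exact ⟨A, ⟨hA, hB⟩, (hf.setOf_smul_eq_compl_map (hFT hA)).symm⟩
  rintro _ ⟨A, hA, rfl⟩
  rw [← key] at hA
  exact hA.2

end IsEnl

/-- An equivariant monotone symmetric function defined on a left-invariant symmetric family
extends to the whole power set. -/
theorem exists_isEnl_extension (F : Set (Set X)) (φ : Set X → Set X)
    (hinv : ∀ A ∈ F, ∀ x : X, x • A ∈ F) (hcompl : ∀ A ∈ F, Aᶜ ∈ F)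
    (hφ_smul : ∀ A ∈ F, ∀ x : X, φ (x • A) = x • φ A)
    (hφ_mono : ∀ A ∈ F, ∀ B ∈ F, A ⊆ B → φ A ⊆ φ B)
    (hφ_compl : ∀ A ∈ F, φ Aᶜ = (φ A)ᶜ) :
    ∃ h, IsEnl h ∧ ∀ A ∈ F, h A = φ A := by
  have hL₀ : {A | A ∈ F ∧ 1 ∈ φ A} ∈
      {L : Set (Set X) | ∀ A ∈ L, ∀ B ∈ L, (A ∩ B).Nonempty} := by
    rintro A ⟨hA, h1A⟩ B ⟨hB, h1B⟩
    by_contra hne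
    have hsub : A ⊆ Bᶜ :=
      Set.disjoint_left.1 (Set.disjoint_iff_inter_eq_empty.2 (Set.not_nonempty_iff_eq_empty.1 hne))
    have := hφ_mono A hA _ (hcompl B hB) hsub h1A
    rw [hφ_compl B hB] at this
    exact this h1B
  obtain ⟨L, hL₀L, hL⟩ := zorn_subset_nonempty
    {L : Set (Set X) | ∀ A ∈ L, ∀ B ∈ L, (A ∩ B).Nonempty} (by
      intro c hc hchain _
      refine ⟨⋃₀ c, ?_, fun s hs => Set.subset_sUnion_of_mem hs⟩
      rintro A ⟨s, hs, hA⟩ B ⟨t, ht, hB⟩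
      obtain ⟨u, hu, hsu, htu⟩ := hchain.directedOn s hs t ht
      exact hc hu A (hsu hA) B (htu hB)) _ hL₀
  have hlink : ∀ A ∈ L, ∀ B ∈ L, (A ∩ B).Nonempty := hL.prop
  have hins : ∀ A ∉ L, A = ∅ ∨ ∃ B ∈ L, B ⊆ Aᶜ := by
    intro A hA
    by_contra! hcon
    obtain ⟨hAne, hB⟩ := hcon
    have hB' : ∀ B ∈ L, (B ∩ A).Nonempty := fun B hBL => by
      obtain ⟨x, hx, hx'⟩ := Set.not_subset.1 (hB B hBL)
      exact ⟨x, hx, not_not.1 hx'⟩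
    refine hA ((hL.eq_of_subset (t := insert A L) ?_ (Set.subset_insert A L)) ▸
      Set.mem_insert A L)
    rintro B (rfl | hBL) C (rfl | hCL)
    · simpa [Set.nonempty_iff_ne_empty] using hAne
    · rw [Set.inter_comm]; exact hB' C hCL
    · exact hB' B hBL
    · exact hlink B hBL C hCL
  have htotal : ∀ A, Aᶜ ∈ L ↔ A ∉ L := by
    intro A
    constructor
    · intro h h'
      obtain ⟨x, hx, hx'⟩ := hlink _ h _ h'
      exact hx hx'
    · intro h
      by_contra h'
      rcases hins A h with h1 | ⟨B, hB, hBA⟩ <;> rcases hins _ h' with h2 | ⟨C, hC, hCA⟩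
      · have : (1 : X) ∈ Aᶜ := by rw [h1]; simp
        rw [h2] at this
        exact this
      · obtain ⟨x, hx, -⟩ := hlink C hC C hC
        have := hCA hx
        rw [compl_compl, h1] at this
        exact this
      · obtain ⟨x, hx, -⟩ := hlink B hB B hB
        have := hBA hx
        rw [h2] at this
        exact this
      · obtain ⟨x, hx, hx'⟩ := hlink B hB C hC
        exact hCA hx' (hBA hx)
  have hup : ∀ A ∈ L, ∀ B, A ⊆ B → B ∈ L := by
    intro A hA B hAB
    by_contra hB
    obtain ⟨x, hx, hx'⟩ := hlink A hA _ ((htotal B).2 hB)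
    exact hx' (hAB hx)
  refine ⟨fun A => {x | x⁻¹ • A ∈ L}, ⟨fun x A => ?_, fun A B hAB x hx => ?_, fun A => ?_⟩,
    fun A hA => ?_⟩
  · ext y
    simp [Set.mem_smul_set_iff_inv_smul_mem, smul_smul]
  · exact hup _ hx _ (Set.smul_set_mono hAB)
  · ext y
    simp only [Set.mem_ofPred_eq, Set.smul_set_compl, htotal, Set.mem_compl_iff]
  · have hmem : ∀ B ∈ F, B ∈ L ↔ 1 ∈ φ B := by
      intro B hB
      refine ⟨fun h => ?_, fun h => hL₀L ⟨hB, h⟩⟩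
      by_contra h'
      refine (htotal B).1 (hL₀L ⟨hcompl B hB, ?_⟩) h
      rw [hφ_compl B hB]
      exact h'
    ext x
    rw [Set.mem_ofPred_eq, hmem _ (hinv A hA _), hφ_smul A hA, Set.mem_smul_set_iff_inv_smul_mem]
    simp

end Enl

section Covering

variable {X : Type*} [Group X]

theorem IsMinKCovering.exists_smul_eq {F : Set (Set X)} (hF : IsMinKCovering F) {A B : Set X}
    (hA : A ∈ F) (hB : B ∈ F) (h : {x : X | x • A = Aᶜ} = {x : X | x • B = Bᶜ}) :
    ∃ x : X, x • A = B := by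
  by_contra! hne
  have key : F \ {C | ∃ x : X, x • B = C} = F := by
    refine hF.2 _ Set.sdiff_subset ⟨?_, fun K hK => ?_⟩
    · rintro C ⟨hC, hCB⟩ x
      refine ⟨hF.1.1 C hC x, ?_⟩
      rintro ⟨y, hy⟩
      exact hCB ⟨x⁻¹ * y, by rw [← smul_smul, hy, inv_smul_smul]⟩
    · obtain ⟨C, hC, rfl⟩ := hF.1.2 K hK
      by_cases hCB : ∃ x : X, x • B = C
      · obtain ⟨x, rfl⟩ := hCB
        refine ⟨x • A, ⟨hF.1.1 A hA x, ?_⟩, setOf_smul_eq_compl_smul_congr h x⟩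
        rintro ⟨y, hy⟩
        exact hne (y⁻¹ * x) (by rw [← smul_smul, ← hy, inv_smul_smul])
      · exact ⟨C, ⟨hC, hCB⟩, rfl⟩
  rw [← key] at hB
  exact hB.2 ⟨1, one_smul _ _⟩

theorem IsEnl.injOn_of_isMinKCovering {g : Set X → Set X} (hg : IsEnl g) {F : Set (Set X)}
    (hF : IsMinKCovering F) (hFT : F ⊆ TwinHat X) : Set.InjOn g F := by
  intro A hA B hB hAB
  have hFix : {x : X | x • A = Aᶜ} = {x : X | x • B = Bᶜ} := by
    rw [← hg.setOf_smul_eq_compl_map (hFT hA), ← hg.setOf_smul_eq_compl_map (hFT hB), hAB]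
  obtain ⟨x, rfl⟩ := hF.exists_smul_eq hA hB hFix
  rw [hg.map_smul] at hAB
  exact ((smul_eq_iff_of_setOf_smul_eq_compl_eq (hFT hA).1.1
    (hg.setOf_smul_eq_compl_map (hFT hA)).symm x).2 hAB.symm).symm

variable (X) in
theorem exists_isMinKCovering_subset_twinHat :
    ∃ F : Set (Set X), IsMinKCovering F ∧ F ⊆ TwinHat X := by
  let r : Setoid (TwinHat X) :=
    { r := fun A B => ∃ x : X, {y : X | y • A.1 = A.1ᶜ} =
        {y : X | y • x • B.1 = (x • B.1)ᶜ}
      iseqv := by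
        refine ⟨fun A => ⟨1, by simp only [one_smul]⟩, ?_, ?_⟩
        · rintro A B ⟨x, hx⟩
          refine ⟨x⁻¹, ?_⟩
          have := setOf_smul_eq_compl_smul_congr hx x⁻¹
          simp only [inv_smul_smul] at this
          exact this.symm
        · rintro A B C ⟨x, hx⟩ ⟨y, hy⟩
          refine ⟨x * y, hx.trans ?_⟩
          simp only [← smul_smul]
          exact setOf_smul_eq_compl_smul_congr hy x }
  let F : Set (Set X) := {B | ∃ (q : Quotient r) (x : X), x • q.out.1 = B}
  have hcov : IsKCovering F := by
    refine ⟨?_, fun K hK => ?_⟩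
    · rintro _ ⟨q, x, rfl⟩ y
      exact ⟨q, y * x, (smul_smul y x _).symm⟩
    · obtain ⟨A, rfl⟩ := hK.exists_setOf_smul_eq_compl
      obtain ⟨x, hx⟩ : r ⟨A, hK⟩ (Quotient.mk r ⟨A, hK⟩).out :=
        r.symm (Quotient.exact (Quotient.out_eq (Quotient.mk r ⟨A, hK⟩)))
      exact ⟨_, ⟨_, x, rfl⟩, hx.symm⟩
  refine ⟨F, ⟨hcov, fun F' hsub hF' => hsub.antisymm ?_⟩, ?_⟩
  · rintro _ ⟨q, x, rfl⟩
    obtain ⟨B, hB, hBq⟩ := hF'.2 _ q.out.2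
    obtain ⟨q', y, rfl⟩ := hsub hB
    have hqq : q = q' := by
      rw [← q.out_eq, ← q'.out_eq]
      exact Quotient.sound ⟨y, hBq.symm⟩
    subst hqq
    have := hF'.1 _ hB (x * y⁻¹)
    rwa [smul_smul, inv_mul_cancel_right] at this
  · rintro _ ⟨q, x, rfl⟩
    exact smul_mem_twinHat q.out.2 x

end Covering

section Twinic

variable {X : Type*} [Group X]

/-- Sets that are twins modulo an ideal can be sent equivariantly into any covering family. -/
theorem IsLeftInvariantIdeal.exists_twin_selector {I F : Set (Set X)}
    (hI : IsLeftInvariantIdeal I) (hF : IsKCovering F) :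
    ∃ t : Set X → Set X, ∀ A : Set X, {x : X | EqMod I (x • A) Aᶜ}.Nonempty →
      t A ∈ F ∧ (∀ x : X, EqMod I (x • A) Aᶜ → x • t A = (t A)ᶜ) ∧
      ∀ (B : Set X) (y : X), EqMod I B (y • A) → t B = y • t A := by
  classical
  let r : Setoid (Set X) :=
    { r := fun A B => ∃ x : X, EqMod I A (x • B)
      iseqv := by
        refine ⟨fun A => ⟨1, by rw [one_smul]; exact hI.eqMod_refl A⟩, ?_, ?_⟩
        · rintro A B ⟨x, hx⟩
          have := hI.eqMod_smul hx x⁻¹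
          rw [inv_smul_smul] at this
          exact ⟨x⁻¹, this.symm⟩
        · rintro A B C ⟨x, hx⟩ ⟨y, hy⟩
          have := hI.eqMod_smul hy x
          rw [smul_smul] at this
          exact ⟨x * y, hI.eqMod_trans hx this⟩ }
  have hrep : ∀ A : Set X, ∃ x : X, EqMod I A (x • (Quotient.mk r A).out) := fun A =>
    r.symm (Quotient.exact (Quotient.out_eq (Quotient.mk r A)))
  choose s hs using hrep
  have hΦ : ∀ R : Set X, ∃ C : Set X, {x : X | EqMod I (x • R) Rᶜ}.Nonempty →
      C ∈ F ∧ ∀ x : X, EqMod I (x • R) Rᶜ → x • C = Cᶜ := by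
    intro R
    by_cases hR : {x : X | EqMod I (x • R) Rᶜ}.Nonempty
    · obtain ⟨K, hK, hRK⟩ := (hI.isTwoCogroup_setOf_eqMod hR).exists_isMaxTwoCogroup
      obtain ⟨C, hC, rfl⟩ := hF.2 K hK
      exact ⟨C, fun _ => ⟨hC, fun x hx => hRK hx⟩⟩
    · exact ⟨∅, fun h => absurd h hR⟩
  choose Φ hΦ using hΦ
  have hconj : ∀ (A R : Set X) (s x : X), EqMod I A (s • R) → EqMod I (x • A) Aᶜ →
      EqMod I ((s⁻¹ * x * s) • R) Rᶜ := by
    intro A R s x hA hx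
    have h1 := hI.eqMod_trans (hI.eqMod_trans (hI.eqMod_smul hA x).symm hx) hA.compl
    have h2 := hI.eqMod_smul h1 s⁻¹
    rwa [← Set.smul_set_compl, inv_smul_smul, smul_smul, smul_smul] at h2
  refine ⟨fun A => s A • Φ (Quotient.mk r A).out, fun A hA => ?_⟩
  set R := (Quotient.mk r A).out with hR
  obtain ⟨k, hk⟩ := hA
  have hkR := hconj A R (s A) k (hs A) hk
  obtain ⟨hΦF, hΦfix⟩ := hΦ R ⟨_, hkR⟩
  refine ⟨hF.1 _ hΦF _, fun x hx => ?_, fun B y hB => ?_⟩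
  · exact smul_smul_set_eq_compl_iff.2 (hΦfix _ (hconj A R (s A) x (hs A) hx))
  · have hBA : Quotient.mk r B = Quotient.mk r A := Quotient.sound ⟨y, hB⟩
    have hsB := hs B
    simp only [hBA] at hsB ⊢
    rw [← hR] at hsB ⊢
    have h1 : EqMod I (s B • R) ((y * s A) • R) := by
      rw [← smul_smul]
      exact hI.eqMod_trans hsB.symm (hI.eqMod_trans hB (hI.eqMod_smul (hs A) y))
    set u := (s A)⁻¹ * k * s A
    have h2 : EqMod I ((u * ((s B)⁻¹ * (y * s A))) • R) Rᶜ := by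
      have h3 := hI.eqMod_smul h1 (u * (s B)⁻¹)
      rw [smul_smul, smul_smul, inv_mul_cancel_right, mul_assoc] at h3
      exact hI.eqMod_trans h3.symm hkR
    have h4 := hΦfix _ h2
    rw [← smul_smul, ← hΦfix u hkR, smul_left_cancel_iff, ← smul_smul, inv_smul_eq_iff,
      ← smul_smul] at h4
    exact h4.symm

/-- In a twinic group every set outside the twins modulo the ideal can be decided by an invariant
upfamily of pairwise intersecting sets modulo the ideal. -/
theorem IsTwinicIdeal.exists_invariant_linked {I : Set (Set X)} (hI : IsLeftInvariantIdeal I)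
    (hT : IsTwinicIdeal I) :
    ∃ M : Set (Set X), (∀ A ∈ M, ∀ x : X, x • A ∈ M) ∧ (∀ A ∈ M, ∀ B ∈ M, A ∩ B ∉ I) ∧
      ∀ A, A ∈ M ∨ Aᶜ ∈ M ∨ ∃ x : X, EqMod I (x • A) Aᶜ := by
  obtain ⟨M, -, hM⟩ := zorn_subset_nonempty
    {M : Set (Set X) | (∀ A ∈ M, ∀ x : X, x • A ∈ M) ∧ ∀ A ∈ M, ∀ B ∈ M, A ∩ B ∉ I} (by
      intro c hc hchain _
      refine ⟨⋃₀ c, ⟨?_, ?_⟩, fun s hs => Set.subset_sUnion_of_mem hs⟩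
      · rintro A ⟨s, hs, hA⟩ x
        exact ⟨s, hs, (hc hs).1 A hA x⟩
      · rintro A ⟨s, hs, hA⟩ B ⟨t, ht, hB⟩
        obtain ⟨u, hu, hsu, htu⟩ := hchain.directedOn s hs t ht
        exact (hc hu).2 A (hsu hA) B (htu hB)) ∅ (by simp)
  obtain ⟨hinv, hlink⟩ := hM.prop
  refine ⟨M, hinv, hlink, ?_⟩
  have hins : ∀ A ∉ M, (∃ x : X, (x • A) ∩ A ∈ I) ∨ ∃ B ∈ M, B ∩ A ∈ I := by
    intro A hA
    by_contra! hcon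
    obtain ⟨h1, h2⟩ := hcon
    have h2' : ∀ B ∈ M, ∀ x : X, B ∩ (x • A) ∉ I := by
      intro B hB x h
      refine h2 _ (hinv B hB x⁻¹) ?_
      have := hI.2.2.2.2 _ h x⁻¹
      rwa [Set.smul_set_inter, inv_smul_smul] at this
    refine hA ((hM.eq_of_subset (t := M ∪ {B | ∃ x : X, x • A = B}) ⟨?_, ?_⟩
      Set.subset_union_left) ▸ Or.inr ⟨1, one_smul _ _⟩)
    · rintro B (hB | ⟨y, rfl⟩) x
      · exact Or.inl (hinv B hB x)
      · exact Or.inr ⟨x * y, (smul_smul x y A).symm⟩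
    · rintro B (hB | ⟨y, rfl⟩) C (hC | ⟨z, rfl⟩)
      · exact hlink B hB C hC
      · exact h2' B hB z
      · rw [Set.inter_comm]; exact h2' C hC y
      · intro h
        refine h1 (z⁻¹ * y) ?_
        have := hI.2.2.2.2 _ h z⁻¹
        rwa [Set.smul_set_inter, inv_smul_smul, smul_smul] at this
  intro A
  by_contra! hcon
  obtain ⟨hA, hA', hne⟩ := hcon
  rcases hins A hA with ⟨x, hx⟩ | ⟨B, hB, hBA⟩ <;> rcases hins _ hA' with ⟨y, hy⟩ | ⟨C, hC, hCA⟩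
  · have h1 : (x • A) \ Aᶜ ∈ I := by rwa [Set.sdiff_compl]
    have h2 : Aᶜ \ (y • A) ∈ I := by
      rwa [Set.sdiff_eq, ← Set.smul_set_compl, Set.inter_comm]
    have h3 := hT A x y h1 h2
    exact hne x ⟨h1, hI.diff_trans h2 h3.2⟩
  · have h1 : (x • C) \ (x • A) ∈ I := hI.diff_smul (by rwa [Set.sdiff_eq]) x
    have h2 : (x • A) \ Aᶜ ∈ I := by rwa [Set.sdiff_compl]
    have h3 : Aᶜ \ Cᶜ ∈ I := compl_diff_compl_mem (by rwa [Set.sdiff_eq])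
    have h4 := hI.diff_trans (hI.diff_trans h1 h2) h3
    rw [Set.sdiff_compl] at h4
    exact hlink _ (hinv C hC x) _ hC h4
  · have h1 : (y • B) \ (y • Aᶜ) ∈ I := hI.diff_smul (by rwa [Set.sdiff_compl]) y
    have h2 : (y • Aᶜ) \ A ∈ I := by rwa [Set.sdiff_eq]
    have h3 : A \ Bᶜ ∈ I := by rwa [Set.sdiff_compl, Set.inter_comm]
    have h4 := hI.diff_trans (hI.diff_trans h1 h2) h3
    rw [Set.sdiff_compl] at h4
    exact hlink _ (hinv B hB y) _ hB h4
  · have h1 : B \ Aᶜ ∈ I := by rwa [Set.sdiff_compl]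
    have h2 : Aᶜ \ Cᶜ ∈ I := compl_diff_compl_mem (by rwa [Set.sdiff_eq])
    have h3 := hI.diff_trans h1 h2
    rw [Set.sdiff_compl] at h3
    exact hlink B hB C hC h3

theorem IsTwinicIdeal.eqMod_of_diff_mem {I : Set (Set X)} (hI : IsLeftInvariantIdeal I)
    (hT : IsTwinicIdeal I) {A B : Set X} {x y : X} (hA : EqMod I (x • A) Aᶜ)
    (hB : EqMod I (y • B) Bᶜ) (hAB : A \ B ∈ I) : EqMod I A B := by
  have h1 : Bᶜ \ Aᶜ ∈ I := compl_diff_compl_mem hAB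
  have h2 : Bᶜ \ (x • A) ∈ I := hI.diff_trans h1 hA.2
  have h3 : (x • A) \ (x • B) ∈ I := hI.diff_smul hAB x
  have h4 := hT B y x hB.1 (hI.diff_trans h2 h3)
  have h5 : Aᶜ \ Bᶜ ∈ I :=
    hI.diff_trans hA.2 (hI.diff_trans h3 (hI.diff_trans h4.2 hB.1))
  have h6 := compl_diff_compl_mem h5
  rw [compl_compl, compl_compl] at h6
  exact ⟨hAB, h6⟩

theorem IsTwinicIdeal.exists_isEnl_range_subset {I F : Set (Set X)}
    (hI : IsLeftInvariantIdeal I) (hT : IsTwinicIdeal I) (hF : IsKCovering F) :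
    ∃ e : Set X → Set X, IsEnl e ∧ (∀ A, e A ∈ ({∅, Set.univ} : Set (Set X)) ∪ F) ∧
      ∀ A B, EqMod I A B → e A = e B := by
  classical
  obtain ⟨t, ht⟩ := hI.exists_twin_selector hF
  obtain ⟨M, hinv, hlink, htri⟩ := hT.exists_invariant_linked hI
  have hnot : ∀ A ∈ M, Aᶜ ∉ M := fun A hA hA' =>
    hlink A hA _ hA' (by rw [Set.inter_compl_self]; exact hI.1)
  have hup : ∀ A ∈ M, ∀ B, A \ B ∈ I → B ∈ M := by
    intro A hA B hAB
    rcases htri B with h | h | ⟨x, hx⟩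
    · exact h
    · exact absurd (by rwa [← Set.sdiff_eq]) (hlink A hA _ h)
    · have h1 := hI.diff_trans (hI.diff_smul hAB x) hx.1
      have h2 := hI.diff_trans h1 (compl_diff_compl_mem hAB)
      rw [Set.sdiff_compl] at h2
      exact absurd h2 (hlink _ (hinv A hA x) A hA)
  have hsmul : ∀ A (x : X), x • A ∈ M ↔ A ∈ M := by
    refine fun A x => ⟨fun h => ?_, fun h => hinv A h x⟩
    have := hinv _ h x⁻¹
    rwa [inv_smul_smul] at this
  let e : Set X → Set X := fun A => if A ∈ M then Set.univ else if Aᶜ ∈ M then ∅ else t A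
  have e_pos : ∀ A ∈ M, e A = Set.univ := fun A hA => if_pos hA
  have e_neg : ∀ A, Aᶜ ∈ M → e A = ∅ := fun A hA => by
    have : A ∉ M := fun h => hnot A h hA
    simp only [e, if_neg this, if_pos hA]
  have e_twin : ∀ A, A ∉ M → Aᶜ ∉ M → e A = t A := fun A h h' => by
    simp only [e, if_neg h, if_neg h']
  have htwin : ∀ A, A ∉ M → Aᶜ ∉ M → {x : X | EqMod I (x • A) Aᶜ}.Nonempty := fun A h h' => by
    rcases htri A with h1 | h1 | h1
    · exact absurd h1 h
    · exact absurd h1 h'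
    · exact h1
  have hmono : ∀ A B, A \ B ∈ I → e A ⊆ e B := by
    intro A B hAB
    by_cases hA' : Aᶜ ∈ M
    · rw [e_neg A hA']; exact Set.empty_subset _
    by_cases hB : B ∈ M
    · rw [e_pos B hB]; exact Set.subset_univ _
    have hA : A ∉ M := fun h => hB (hup A h B hAB)
    have hB' : Bᶜ ∉ M := fun h => hA' (hup _ h _ (compl_diff_compl_mem hAB))
    obtain ⟨x, hx⟩ := htwin A hA hA'
    obtain ⟨y, hy⟩ := htwin B hB hB'
    have heq := hT.eqMod_of_diff_mem hI hx hy hAB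
    rw [e_twin A hA hA', e_twin B hB hB',
      (ht B ⟨y, hy⟩).2.2 A 1 (by rwa [one_smul]), one_smul]
  refine ⟨e, ⟨fun x A => ?_, fun A B h => hmono A B (hI.diff_of_subset h), fun A => ?_⟩,
    fun A => ?_, fun A B h => (hmono A B h.1).antisymm (hmono B A h.2)⟩
  · by_cases hA : A ∈ M
    · rw [e_pos A hA, e_pos _ (hinv A hA x), Set.smul_set_univ]
    by_cases hA' : Aᶜ ∈ M
    · rw [e_neg A hA', e_neg _ (by rw [← Set.smul_set_compl]; exact hinv _ hA' x),
        Set.smul_set_empty]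
    rw [e_twin A hA hA', e_twin _ (by rwa [hsmul]) (by rwa [← Set.smul_set_compl, hsmul])]
    exact (ht A (htwin A hA hA')).2.2 _ x (hI.eqMod_refl _)
  · by_cases hA : A ∈ M
    · rw [e_pos A hA, e_neg _ (by rwa [compl_compl]), Set.compl_univ]
    by_cases hA' : Aᶜ ∈ M
    · rw [e_neg A hA', e_pos _ hA', Set.compl_empty]
    obtain ⟨k, hk⟩ := htwin A hA hA'
    rw [e_twin A hA hA', e_twin _ hA' (by rwa [compl_compl]),
      (ht A ⟨k, hk⟩).2.2 Aᶜ k (EqMod.symm hk), (ht A ⟨k, hk⟩).2.1 k hk]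
  · by_cases hA : A ∈ M
    · rw [e_pos A hA]; simp
    by_cases hA' : Aᶜ ∈ M
    · rw [e_neg A hA']; simp
    rw [e_twin A hA hA']
    exact Or.inr (ht A (htwin A hA hA')).1

/-- An equivariant monotone symmetric function is left-invertible on a minimal covering family. -/
theorem IsTwinicIdeal.exists_isEnl_leftInvOn {I F : Set (Set X)}
    (hI : IsLeftInvariantIdeal I) (hT : IsTwinicIdeal I) (hF : IsMinKCovering F)
    (hFT : F ⊆ TwinHat X) {g : Set X → Set X} (hg : IsEnl g) :
    ∃ h, IsEnl h ∧ Set.LeftInvOn h g F := by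
  obtain ⟨e, he, -, heI⟩ := hT.exists_isEnl_range_subset hI hF.1
  have hinj := hg.injOn_of_isMinKCovering hF hFT
  have hcompl : ∀ B ∈ F, Bᶜ ∈ F := by
    intro B hB
    obtain ⟨k, hk⟩ := (hFT hB).1.1
    rw [← (hk : k • B = Bᶜ)]
    exact hF.1.1 B hB k
  have hinv := hinj.leftInvOn_invFunOn
  obtain ⟨h, hh, hext⟩ := exists_isEnl_extension (g '' F) (Function.invFunOn g F)
    (by
      rintro _ ⟨B, hB, rfl⟩ x
      exact ⟨x • B, hF.1.1 B hB x, hg.map_smul x B⟩)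
    (by
      rintro _ ⟨B, hB, rfl⟩
      exact ⟨Bᶜ, hcompl B hB, hg.map_compl B⟩)
    (by
      rintro _ ⟨B, hB, rfl⟩ x
      rw [← hg.map_smul, hinv hB, hinv (hF.1.1 B hB x)])
    (by
      rintro _ ⟨B, hB, rfl⟩ _ ⟨C, hC, rfl⟩ hBC
      obtain ⟨x, hx⟩ := (hg.map_mem_twinHat (hFT hB)).1.1
      obtain ⟨y, hy⟩ := (hg.map_mem_twinHat (hFT hC)).1.1
      have hx : x • g B = (g B)ᶜ := hx
      have hy : y • g C = (g C)ᶜ := hy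
      have heq : EqMod I (g B) (g C) := hT.eqMod_of_diff_mem hI (x := x) (y := y)
        (by rw [hx]; exact hI.eqMod_refl _) (by rw [hy]; exact hI.eqMod_refl _)
        (hI.diff_of_subset hBC)
      rw [(hg.comp he).injOn_of_isMinKCovering hF hFT hB hC (heI _ _ heq)])
    (by
      rintro _ ⟨B, hB, rfl⟩
      rw [← hg.map_compl, hinv hB, hinv (hcompl B hB)])
  exact ⟨h, hh, fun B hB => by rw [hext _ ⟨B, hB, rfl⟩, hinv hB]⟩

end Twinic

/-- For a twinic group `X` and `f` in the monoid `Enl` of equivariant monotone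
symmetric self-maps of `P(X)`, `f` belongs to the minimal ideal of `Enl` (for every `g ∈ Enl`
there is `h ∈ Enl` with `h∘g∘f = f`) if and only if the family `f(T̂)` is minimal
`K̂`-covering and `f(A) ∈ {∅, X} ∪ f(T̂)` for every `A ⊆ X`. -/
theorem stmt19 {X : Type*} [Group X]
    (htwinic : ∃ I : Set (Set X), IsLeftInvariantIdeal I ∧ IsTwinicIdeal I)
    (f : Set X → Set X) (hf : IsEnl f) :
    (∀ g : Set X → Set X, IsEnl g → ∃ h : Set X → Set X, IsEnl h ∧ h ∘ g ∘ f = f) ↔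
    (IsMinKCovering (f '' TwinHat X) ∧
     ∀ A : Set X, f A ∈ ({∅, Set.univ} : Set (Set X)) ∪ f '' TwinHat X) := by
  obtain ⟨I, hI, hT⟩ := htwinic
  have hfT : f '' TwinHat X ⊆ TwinHat X := by
    rintro _ ⟨A, hA, rfl⟩
    exact hf.map_mem_twinHat hA
  constructor
  · intro hmin
    obtain ⟨F, hF, hFT⟩ := exists_isMinKCovering_subset_twinHat X
    obtain ⟨e, he, heF, -⟩ := hT.exists_isEnl_range_subset hI hF.1
    obtain ⟨h, hh, hhef⟩ := hmin e he
    have himage : e '' (f '' TwinHat X) = F := by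
      refine hF.2 _ ?_ (he.isKCovering_image (hf.isKCovering_image isKCovering_twinHat le_rfl) hfT)
      rintro _ ⟨B, hB, rfl⟩
      have hmem := he.map_mem_twinHat (hfT hB)
      rcases heF B with (h0 | h1) | h2
      · exact absurd h0 (TwinHat.ne_empty hmem)
      · exact absurd h1 (TwinHat.ne_univ hmem)
      · exact h2
    have hhF : h '' F = f '' TwinHat X := by
      rw [← himage, Set.image_image, Set.image_image]
      exact Set.image_congr fun A _ => congrFun hhef A
    refine ⟨hhF ▸ hh.isMinKCovering_image hF hFT, fun A => ?_⟩
    rw [← congrFun hhef A, ← hhF]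
    simp only [Function.comp_apply]
    rcases heF (f A) with (h0 | h1) | h2
    · rw [h0, hh.map_empty]; simp
    · rw [h1, hh.map_univ]; simp
    · exact Or.inr ⟨_, h2, rfl⟩
  · rintro ⟨hF, hrange⟩ g hg
    obtain ⟨h, hh, hinv⟩ := hT.exists_isEnl_leftInvOn hI hF hfT hg
    refine ⟨h, hh, funext fun A => ?_⟩
    simp only [Function.comp_apply]
    rcases hrange A with (h0 | h1) | h2
    · rw [h0, hg.map_empty, hh.map_empty]
    · rw [h1, hg.map_univ, hh.map_univ]
    · exact hinv h2
end
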